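/- Let τ > 0, α ∈ ℂ, m ≤ q and n ≤ p nonnegative integers, a ∈ ℂ^p, b ∈ ℂ^q with λ♯ < λ♭, and suppose that either N > 0, or N = 0 and Re(α) > 0. Then for every s ∈ ℂ with λ♯ < Re(s) < λ♭, the Mellin transform integral ∫₀^∞ K^{m,n}_{p,q}(a;b | x; τ, α)·x^{s−1} dx converges absolutely and ∫₀^∞ K^{m,n}_{p,q}(a;b | x; τ, α)·x^{s−1} dx = exp((πα/τ)·s²)·𝒢^{m,n}_{p,q}(a;b | s; τ). -/

import Mathlib

open Complex Filter MeasureTheory Set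

noncomputable section

/-- The digamma function ψ = Γ'/Γ. -/
def digammaC (z : ℂ) : ℂ := deriv Complex.Gamma z / Complex.Gamma z

/-- The gamma modular form C(τ). -/
def gammaModC (τ : ℂ) : ℂ :=
  limUnder atTop fun M : ℕ =>
    (∑ k ∈ Finset.Ico 1 M, digammaC (k * τ)) + digammaC (M * τ) / 2
      - (1 / τ) * Complex.log (Complex.Gamma (M * τ) / (Real.sqrt (2 * Real.pi) : ℂ))

/-- The gamma modular form D(τ). -/
def gammaModD (τ : ℂ) : ℂ :=
  limUnder atTop fun M : ℕ =>
    (∑ k ∈ Finset.Ico 1 M, deriv digammaC (k * τ)) + deriv digammaC (M * τ) / 2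
      - (1 / τ) * digammaC (M * τ)

def aBarnes (τ : ℂ) : ℂ :=
  -(Real.eulerMascheroniConstant : ℂ) * τ + (τ / 2) * Complex.log (2 * Real.pi * τ)
    + (1 / 2) * Complex.log τ - τ * gammaModC τ

def bBarnes (τ : ℂ) : ℂ :=
  -(Real.pi : ℂ) ^ 2 * τ ^ 2 / 6 - τ * Complex.log τ - τ ^ 2 * gammaModD τ

/-- The Barnes double gamma function `G(z;τ)`, via its Weierstrass product. -/
def barnesG (z τ : ℂ) : ℂ :=
  z / τ * Complex.exp (aBarnes τ * z / τ + bBarnes τ * z ^ 2 / (2 * τ)) *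
    ∏' mn : ℕ × ℕ,
      if mn = (0, 0) then 1
      else (1 + z / (mn.1 * τ + mn.2)) *
        Complex.exp (-(z / (mn.1 * τ + mn.2)) + z ^ 2 / (2 * ((mn.1 : ℂ) * τ + (mn.2 : ℂ)) ^ 2))

/-- The ratio of Barnes double gamma functions `𝒢^{m,n}_{p,q}(a;b | s;τ)`. -/
def calG (m n : ℕ) {p q : ℕ} (a : Fin p → ℂ) (b : Fin q → ℂ) (s τ : ℂ) : ℂ :=
  ((∏ j : Fin q, if (j : ℕ) < m then barnesG (b j - s) τ else 1) *
      ∏ j : Fin p, if (j : ℕ) < n then barnesG (1 + τ - a j + s) τ else 1) /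
    ((∏ j : Fin q, if m ≤ (j : ℕ) then barnesG (1 + τ - b j + s) τ else 1) *
      ∏ j : Fin p, if n ≤ (j : ℕ) then barnesG (a j - s) τ else 1)

/-- `N = 2(m+n) - p - q`. -/
def paramN (m n p q : ℕ) : ℤ := 2 * (m + n) - p - q

/-- `ν = Σ a_j - Σ b_j`. -/
def paramNu {p q : ℕ} (a : Fin p → ℂ) (b : Fin q → ℂ) : ℂ := (∑ j, a j) - ∑ j, b j

/-- `μ = Σ_{j≤n} a_j - Σ_{j>n} a_j + Σ_{j≤m} b_j - Σ_{j>m} b_j`. -/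
def paramMu (m n : ℕ) {p q : ℕ} (a : Fin p → ℂ) (b : Fin q → ℂ) : ℂ :=
  (∑ j : Fin p, if (j : ℕ) < n then a j else 0) - (∑ j : Fin p, if n ≤ (j : ℕ) then a j else 0)
    + (∑ j : Fin q, if (j : ℕ) < m then b j else 0) - ∑ j : Fin q, if m ≤ (j : ℕ) then b j else 0

/-- `ξ = Σ_{j≤n} a_j² - Σ_{j>n} a_j² + Σ_{j≤m} b_j² - Σ_{j>m} b_j²`. -/
def paramXi (m n : ℕ) {p q : ℕ} (a : Fin p → ℂ) (b : Fin q → ℂ) : ℂ :=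
  (∑ j : Fin p, if (j : ℕ) < n then a j ^ 2 else 0)
    - (∑ j : Fin p, if n ≤ (j : ℕ) then a j ^ 2 else 0)
    + (∑ j : Fin q, if (j : ℕ) < m then b j ^ 2 else 0)
    - ∑ j : Fin q, if m ≤ (j : ℕ) then b j ^ 2 else 0

/-- The Meijer–Barnes `K`-function with vertical contour `c + iℝ`, at the variable `z > 0`:
`K^{m,n}_{p,q}(a;b | z; τ, α) = (1/(2πi)) ∫_{c+iℝ} 𝒢(s) e^{(πα/τ)s²} z^{-s} ds`. -/
def KfunZ (m n : ℕ) {p q : ℕ} (a : Fin p → ℂ) (b : Fin q → ℂ) (τ α : ℂ) (c : ℝ) (z : ℝ) : ℂ :=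
  1 / (2 * Real.pi * Complex.I) *
    ∫ t : ℝ, (calG m n a b (c + t * Complex.I) τ *
      Complex.exp ((Real.pi : ℂ) * α / τ * (c + t * Complex.I) ^ 2) *
      Complex.exp (-((c + t * Complex.I) * Real.log z))) * Complex.I

section

open scoped Topology FourierTransform

/-- The vertical line integral of a holomorphic function with Gaussian decay in a closed vertical
strip does not depend on the abscissa. -/
theorem integral_vertical_eq_of_gaussian_decay {g : ℂ → ℂ} {σ₁ σ₂ C κ : ℝ} (hκ : 0 < κ)
    (hd : ∀ z : ℂ, σ₁ ≤ z.re → z.re ≤ σ₂ → DifferentiableAt ℂ g z)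
    (hb : ∀ z : ℂ, σ₁ ≤ z.re → z.re ≤ σ₂ → ‖g z‖ ≤ C * Real.exp (-κ * z.im ^ 2))
    {c c' : ℝ} (hc : c ∈ Icc σ₁ σ₂) (hc' : c' ∈ Icc σ₁ σ₂) :
    ∫ t : ℝ, g (c + t * I) = ∫ t : ℝ, g (c' + t * I) := by
  have hcont : ∀ x ∈ Icc σ₁ σ₂, Continuous fun t : ℝ => g (x + t * I) := by
    intro x hx
    rw [continuous_iff_continuousAt]
    intro t
    have h := (hd (x + t * I) (by simpa using hx.1) (by simpa using hx.2)).continuousAt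
    exact ContinuousAt.comp (f := fun t : ℝ => (x + t * I : ℂ)) h (by fun_prop)
  have hinteg : ∀ x ∈ Icc σ₁ σ₂, Integrable fun t : ℝ => g (x + t * I) := by
    intro x hx
    refine ((integrable_exp_neg_mul_sq hκ).const_mul C).mono' (hcont x hx).aestronglyMeasurable
      (Eventually.of_forall fun t => ?_)
    simpa using hb (x + t * I) (by simpa using hx.1) (by simpa using hx.2)
  have hsub : uIcc c c' ⊆ Icc σ₁ σ₂ := by
    rw [← uIcc_of_le (hc.1.trans hc.2)]
    exact uIcc_subset_uIcc (by rwa [uIcc_of_le (hc.1.trans hc.2)])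
      (by rwa [uIcc_of_le (hc.1.trans hc.2)])
  have hlim : ∀ x ∈ Icc σ₁ σ₂, Tendsto (fun T : ℝ => ∫ t in (-T)..T, g (x + t * I)) atTop
      (𝓝 (∫ t : ℝ, g (x + t * I))) := fun x hx =>
    intervalIntegral_tendsto_integral (hinteg x hx) tendsto_neg_atTop_atBot tendsto_id
  have hgauss : Tendsto (fun T : ℝ => C * Real.exp (-κ * T ^ 2) * |c' - c|) atTop (𝓝 0) := by
    have h : Tendsto (fun T : ℝ => Real.exp (-κ * T ^ 2)) atTop (𝓝 0) := by
      refine Real.tendsto_exp_atBot.comp ?_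
      exact (tendsto_pow_atTop two_ne_zero).const_mul_atTop_of_neg (by linarith)
    simpa using (h.const_mul C).mul_const |c' - c|
  have hhor : ∀ ε : ℝ, ε ^ 2 = 1 →
      Tendsto (fun T : ℝ => ∫ x in c..c', g (x + (ε * T : ℝ) * I)) atTop (𝓝 0) := by
    intro ε hε
    refine squeeze_zero_norm (fun T => ?_) hgauss
    refine intervalIntegral.norm_integral_le_of_norm_le_const fun x hx => ?_
    have hx' := hsub (uIoc_subset_uIcc hx)
    have h := hb (x + (ε * T : ℝ) * I) (by simpa using hx'.1) (by simpa using hx'.2)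
    have him : (x + (ε * T : ℝ) * I : ℂ).im = ε * T := by simp
    rwa [him, mul_pow, hε, one_mul] at h
  have hrect : ∀ T : ℝ, (∫ x in c..c', g (x + ((-1) * T : ℝ) * I)) -
      (∫ x in c..c', g (x + (1 * T : ℝ) * I)) + I * (∫ t in (-T)..T, g (c' + t * I)) -
      I * (∫ t in (-T)..T, g (c + t * I)) = 0 := by
    intro T
    have h := integral_boundary_rect_eq_zero_of_differentiableOn g (c + (-T : ℝ) * I) (c' + T * I)
      (by
        intro z hz
        rw [mem_reProdIm] at hz
        have hz1 : z.re ∈ Icc σ₁ σ₂ := hsub (by simpa using hz.1)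
        exact (hd z hz1.1 hz1.2).differentiableWithinAt)
    simpa using h
  have hz := ((((hhor (-1) (by norm_num)).sub (hhor 1 (by norm_num))).add
    ((hlim c' hc').const_mul I)).sub ((hlim c hc).const_mul I))
  have h0 := tendsto_nhds_unique hz ((tendsto_congr hrect).mpr tendsto_const_nhds)
  rw [sub_zero, zero_add, ← mul_sub] at h0
  have := (mul_eq_zero.mp h0).resolve_left I_ne_zero
  exact (sub_eq_zero.mp this).symm

theorem integrable_exp_neg_mul_abs {ε : ℝ} (hε : 0 < ε) :
    Integrable fun u : ℝ => Real.exp (-ε * |u|) := by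
  have h1 : IntegrableOn (fun u : ℝ => Real.exp (-ε * |u|)) (Ioi 0) :=
    (integrableOn_congr_fun (fun u hu => by
      rw [abs_of_pos (show (0 : ℝ) < u from hu)]) measurableSet_Ioi).mpr
      (exp_neg_integrableOn_Ioi 0 hε)
  have h2 : IntegrableOn (fun u : ℝ => Real.exp (-ε * |u|)) (Iic 0) :=
    (integrableOn_congr_fun (fun u hu => by
      rw [abs_of_nonpos (show u ≤ (0 : ℝ) from hu), neg_mul_neg]) measurableSet_Iic).mpr
      (integrableOn_exp_mul_Iic hε 0)
  rw [← integrableOn_univ, ← Iic_union_Ioi (a := (0 : ℝ))]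
  exact h2.union h1

/-- Changing the abscissa in the inverse Mellin transform. -/
theorem mellinInv_eq_of_gaussian_decay {F : ℂ → ℂ} {σ₁ σ₂ C κ : ℝ} (hκ : 0 < κ)
    (hd : ∀ z : ℂ, σ₁ ≤ z.re → z.re ≤ σ₂ → DifferentiableAt ℂ F z)
    (hb : ∀ z : ℂ, σ₁ ≤ z.re → z.re ≤ σ₂ → ‖F z‖ ≤ C * Real.exp (-κ * z.im ^ 2))
    {c c' : ℝ} (hc : c ∈ Icc σ₁ σ₂) (hc' : c' ∈ Icc σ₁ σ₂) {x : ℝ} (hx : 0 < x) :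
    mellinInv c F x = mellinInv c' F x := by
  have hx0 : (x : ℂ) ≠ 0 := ofReal_ne_zero.mpr hx.ne'
  unfold mellinInv
  congr 1
  refine integral_vertical_eq_of_gaussian_decay (g := fun z => (x : ℂ) ^ (-z) • F z)
    (C := Real.exp (|Real.log x| * (|σ₁| + |σ₂|)) * C) hκ ?_ ?_ hc hc'
  · intro z h1 h2
    simp only [smul_eq_mul]
    refine DifferentiableAt.mul ?_ (hd z h1 h2)
    exact DifferentiableAt.const_cpow (by fun_prop) (Or.inl hx0)
  · intro z h1 h2
    rw [norm_smul, mul_assoc]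
    refine mul_le_mul ?_ (hb z h1 h2) (norm_nonneg _) (Real.exp_pos _).le
    rw [norm_cpow_eq_rpow_re_of_pos hx, Real.rpow_def_of_pos hx, Real.exp_le_exp]
    refine (le_abs_self _).trans ?_
    rw [abs_mul]
    refine mul_le_mul_of_nonneg_left ?_ (abs_nonneg _)
    rw [neg_re, abs_neg, abs_le]
    constructor
    · linarith [neg_abs_le σ₁, abs_nonneg σ₂]
    · linarith [le_abs_self σ₂, abs_nonneg σ₁]

/-- A uniform bound for the inverse Mellin transform along a line. -/
theorem norm_mellinInv_le {F : ℂ → ℂ} {c C κ : ℝ} (hκ : 0 < κ)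
    (hb : ∀ z : ℂ, z.re = c → ‖F z‖ ≤ C * Real.exp (-κ * z.im ^ 2))
    {x : ℝ} (hx : 0 < x) :
    ‖mellinInv c F x‖ ≤ 1 / (2 * Real.pi) * (∫ t : ℝ, C * Real.exp (-κ * t ^ 2)) * x ^ (-c) := by
  have h2π : 0 < 1 / (2 * Real.pi) := by positivity
  rw [mellinInv, norm_smul, Real.norm_of_nonneg h2π.le, mul_assoc]
  refine mul_le_mul_of_nonneg_left ?_ h2π.le
  rw [← integral_mul_const]
  refine norm_integral_le_of_norm_le (((integrable_exp_neg_mul_sq hκ).const_mul C).mul_const _)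
    (Eventually.of_forall fun t => ?_)
  rw [norm_smul, mul_comm, norm_cpow_eq_rpow_re_of_pos hx]
  have h := hb (c + t * I) (by simp)
  have h1 : (-(c + t * I : ℂ)).re = -c := by simp
  have h2 : (c + t * I : ℂ).im = t := by simp
  rw [h2] at h
  rw [h1]
  exact mul_le_mul_of_nonneg_right h (Real.rpow_nonneg hx.le _)

/-- The Mellin transform inverts the inverse Mellin transform of a holomorphic function with
Gaussian decay in a vertical strip. -/
theorem mellin_mellinInv_of_gaussian_decay {F : ℂ → ℂ} {σ₁ σ₂ C κ : ℝ} (hκ : 0 < κ)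
    (hd : ∀ z : ℂ, σ₁ ≤ z.re → z.re ≤ σ₂ → DifferentiableAt ℂ F z)
    (hb : ∀ z : ℂ, σ₁ ≤ z.re → z.re ≤ σ₂ → ‖F z‖ ≤ C * Real.exp (-κ * z.im ^ 2))
    {s : ℂ} (hs₁ : σ₁ < s.re) (hs₂ : s.re < σ₂) :
    MellinConvergent (mellinInv s.re F) s ∧ mellin (mellinInv s.re F) s = F s := by
  set σ := s.re with hσ
  set h : ℝ → ℂ := fun y => F (σ + 2 * Real.pi * y * I) with hh
  have hcont : Continuous h := by
    rw [continuous_iff_continuousAt]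
    intro t
    have h := (hd (σ + 2 * Real.pi * t * I) (by simpa using hs₁.le)
      (by simpa using hs₂.le)).continuousAt
    exact ContinuousAt.comp (f := fun t : ℝ => (σ + 2 * Real.pi * t * I : ℂ)) h (by fun_prop)
  have hinteg : Integrable h := by
    refine ((integrable_exp_neg_mul_sq (b := κ * (2 * Real.pi) ^ 2) (by positivity)).const_mul C).mono'
      hcont.aestronglyMeasurable (Eventually.of_forall fun t => ?_)
    have := hb (σ + 2 * Real.pi * t * I) (by simpa using hs₁.le) (by simpa using hs₂.le)
    refine this.trans_eq ?_
    simp only [add_im, ofReal_im, mul_im, mul_re, re_ofNat, ofReal_re, im_ofNat, I_im, I_re]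
    ring_nf
  set B : ℝ := 1 / (2 * Real.pi) * ∫ t : ℝ, C * Real.exp (-κ * t ^ 2) with hB
  have hbd : ∀ c ∈ Icc σ₁ σ₂, ∀ x : ℝ, 0 < x → ‖mellinInv σ F x‖ ≤ B * x ^ (-c) := by
    intro c hc x hx
    rw [mellinInv_eq_of_gaussian_decay hκ hd hb ⟨hs₁.le, hs₂.le⟩ hc hx]
    exact norm_mellinInv_le hκ (fun z hz => hb z (hz ▸ hc.1) (hz ▸ hc.2)) hx
  have hinvcont : Continuous (𝓕⁻ h) := by
    exact VectorFourier.fourierIntegral_continuous Real.continuous_fourierChar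
      (by exact continuous_inner.neg) hinteg
  have hK : ∀ x : ℝ, 0 < x → mellinInv σ F x = (x : ℂ) ^ (-σ : ℂ) • 𝓕⁻ h (-Real.log x) :=
    fun x hx => mellinInv_eq_fourierInv σ F hx
  have hle : σ₁ ≤ σ₂ := (hs₁.trans hs₂).le
  have hexp : ∀ u : ℝ, 𝓕⁻ h u = Real.exp (-σ * u) • mellinInv σ F (Real.exp (-u)) := by
    intro u
    rw [hK _ (Real.exp_pos _), Real.log_exp, neg_neg, ← ofReal_neg,
      ← ofReal_cpow (Real.exp_pos _).le, ← Real.exp_mul, neg_mul_neg, real_smul, smul_eq_mul,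
      ← mul_assoc, ← ofReal_mul, ← Real.exp_add]
    ring_nf
    simp
  have hFint : Integrable (𝓕⁻ h) := by
    set ε := min (σ - σ₁) (σ₂ - σ) with hε
    have hεpos : 0 < ε := lt_min (by linarith) (by linarith)
    refine ((integrable_exp_neg_mul_abs hεpos).const_mul B).mono' hinvcont.aestronglyMeasurable
      (Eventually.of_forall fun u => ?_)
    have key : ∀ c ∈ Icc σ₁ σ₂, ‖𝓕⁻ h u‖ ≤ B * Real.exp ((c - σ) * u) := by
      intro c hc
      rw [hexp, norm_smul, Real.norm_of_nonneg (Real.exp_pos _).le]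
      calc _ ≤ Real.exp (-σ * u) * (B * Real.exp (-u) ^ (-c)) :=
            mul_le_mul_of_nonneg_left (hbd c hc _ (Real.exp_pos _)) (Real.exp_pos _).le
        _ = B * Real.exp ((c - σ) * u) := by
            rw [← Real.exp_mul, mul_left_comm, ← Real.exp_add]
            ring_nf
    have he1 : ε ≤ σ - σ₁ := min_le_left _ _
    have he2 : ε ≤ σ₂ - σ := min_le_right _ _
    rcases le_total 0 u with hu | hu
    · have := key (σ - ε) ⟨by linarith, by linarith⟩
      rw [abs_of_nonneg hu]
      simpa using this
    · have := key (σ + ε) ⟨by linarith, by linarith⟩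
      rw [abs_of_nonpos hu, neg_mul_neg]
      simpa using this
  constructor
  · refine mellinConvergent_of_isBigO_rpow (a := σ₂) (b := σ₁) ?_ ?_ hs₂ ?_ hs₁
    · refine ContinuousOn.locallyIntegrableOn ?_ measurableSet_Ioi
      refine ContinuousOn.congr (f := fun x : ℝ => (x : ℂ) ^ (-σ : ℂ) • 𝓕⁻ h (-Real.log x)) ?_
        (fun x hx => hK x hx)
      intro x hx
      have hx' : (0 : ℝ) < x := hx
      refine ContinuousAt.continuousWithinAt ?_
      simp only [smul_eq_mul]
      refine ContinuousAt.mul ?_ (hinvcont.continuousAt.comp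
        (Real.continuousAt_log hx'.ne').neg)
      exact continuousAt_ofReal_cpow_const x _ (Or.inr hx'.ne')
    · refine Asymptotics.IsBigO.of_bound B ?_
      filter_upwards [eventually_gt_atTop 0] with x hx
      rw [Real.norm_of_nonneg (Real.rpow_nonneg hx.le _)]
      exact hbd σ₂ ⟨hle, le_rfl⟩ x hx
    · refine Asymptotics.IsBigO.of_bound B ?_
      filter_upwards [self_mem_nhdsWithin] with x hx
      rw [Real.norm_of_nonneg (Real.rpow_nonneg (le_of_lt hx) _)]
      exact hbd σ₁ ⟨le_rfl, hle⟩ x hx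
  · rw [mellin_eq_fourier]
    have e : (fun u : ℝ => Real.exp (-s.re * u) • mellinInv σ F (Real.exp (-u))) = 𝓕⁻ h :=
      funext fun u => (hexp u).symm
    have hF2 : Integrable (𝓕 h) := by
      have e2 : 𝓕 h = fun u => 𝓕⁻ h (-u) := by
        ext u
        rw [Real.fourierInv_eq_fourier_neg, neg_neg]
      rw [e2]
      exact hFint.comp_neg
    rw [e, hcont.fourier_fourierInv_eq hinteg hF2, hh]
    have h3 : ((σ : ℂ) + 2 * Real.pi * ((s.im / (2 * Real.pi) : ℝ) : ℂ) * I) = s := by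
      have hp : (Real.pi : ℂ) ≠ 0 := ofReal_ne_zero.mpr Real.pi_ne_zero
      rw [hσ]
      refine Eq.trans ?_ (re_add_im s)
      push_cast
      field_simp
    simp only [h3]

/-- The Weierstrass elementary factor of genus two. -/
def weierstrassE (u : ℂ) : ℂ := (1 + u) * exp (-u + u ^ 2 / 2)

theorem hasDerivAt_weierstrassE (u : ℂ) :
    HasDerivAt weierstrassE (u ^ 2 * exp (-u + u ^ 2 / 2)) u := by
  have h1 : HasDerivAt (fun u : ℂ => -u + u ^ 2 / 2) (-1 + (2 * u) / 2) u := by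
    simpa using (hasDerivAt_neg u).fun_add ((hasDerivAt_pow 2 u).div_const 2)
  have h2 := ((hasDerivAt_id u).const_add 1).mul h1.cexp
  refine h2.congr_deriv ?_
  simp only [id]
  ring

theorem norm_weierstrassE_sub_one_le (u : ℂ) :
    ‖weierstrassE u - 1‖ ≤ ‖u‖ ^ 3 * Real.exp (‖u‖ + ‖u‖ ^ 2 / 2) := by
  have h := (convex_closedBall (0 : ℂ) ‖u‖).norm_image_sub_le_of_norm_hasDerivWithin_le
    (f := weierstrassE) (x := 0) (y := u) (C := ‖u‖ ^ 2 * Real.exp (‖u‖ + ‖u‖ ^ 2 / 2))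
    (fun x _ => (hasDerivAt_weierstrassE x).hasDerivWithinAt)
    (fun x hx => by
      have hx' : ‖x‖ ≤ ‖u‖ := by simpa using hx
      rw [norm_mul, norm_pow, norm_exp]
      have : (-x + x ^ 2 / 2).re ≤ ‖u‖ + ‖u‖ ^ 2 / 2 := by
        refine (re_le_norm _).trans ((norm_add_le _ _).trans ?_)
        rw [norm_neg, norm_div, norm_pow]
        norm_num
        gcongr
      gcongr)
    (by simp) (by simp)
  have h0 : weierstrassE 0 = 1 := by simp [weierstrassE]
  rw [h0, sub_zero] at h
  refine h.trans_eq ?_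
  ring

theorem weierstrassE_ne_zero {u : ℂ} (hu : 1 + u ≠ 0) : weierstrassE u ≠ 0 :=
  mul_ne_zero hu (exp_ne_zero _)

theorem norm_weierstrassE_conj (u : ℂ) :
    ‖weierstrassE (starRingEnd ℂ u)‖ = ‖weierstrassE u‖ := by
  rw [← norm_conj (weierstrassE u)]
  congr 1
  simp [weierstrassE, ← exp_conj, map_ofNat]

/-- The lattice points `mτ + n`. -/
def latticePt (τ : ℝ) (x : ℕ × ℕ) : ℝ := x.1 * τ + x.2

theorem latticePt_nonneg {τ : ℝ} (hτ : 0 < τ) (x : ℕ × ℕ) : 0 ≤ latticePt τ x := by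
  unfold latticePt
  positivity

theorem latticePt_zero (τ : ℝ) : latticePt τ (0, 0) = 0 := by simp [latticePt]

theorem min_mul_le_latticePt {τ : ℝ} (hτ : 0 < τ) {x : ℕ × ℕ} (hx : x ≠ (0, 0)) :
    min τ 1 / 2 * (x.1 + x.2 + 1) ≤ latticePt τ x := by
  have h1 : (1 : ℝ) ≤ x.1 + x.2 := by
    have : 1 ≤ x.1 + x.2 := by
      by_contra h
      exact hx (Prod.ext (by simp; omega) (by simp; omega))
    exact_mod_cast this
  have hδ : 0 < min τ 1 := lt_min hτ one_pos
  have h2 : min τ 1 * x.1 ≤ τ * x.1 :=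
    mul_le_mul_of_nonneg_right (min_le_left _ _) (Nat.cast_nonneg _)
  have h3 : min τ 1 * x.2 ≤ 1 * x.2 :=
    mul_le_mul_of_nonneg_right (min_le_right _ _) (Nat.cast_nonneg _)
  unfold latticePt
  nlinarith

theorem min_le_latticePt {τ : ℝ} (hτ : 0 < τ) {x : ℕ × ℕ} (hx : x ≠ (0, 0)) :
    min τ 1 / 2 ≤ latticePt τ x := by
  refine le_trans ?_ (min_mul_le_latticePt hτ hx)
  have hδ : 0 < min τ 1 := lt_min hτ one_pos
  have : (0 : ℝ) ≤ x.1 + x.2 := by positivity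
  nlinarith

theorem latticePt_pos {τ : ℝ} (hτ : 0 < τ) {x : ℕ × ℕ} (hx : x ≠ (0, 0)) :
    0 < latticePt τ x :=
  lt_of_lt_of_le (by have := lt_min hτ one_pos; positivity) (min_le_latticePt hτ hx)

theorem summable_inv_latticePt_cube {τ : ℝ} (hτ : 0 < τ) :
    Summable fun x : ℕ × ℕ => (latticePt τ x ^ 3)⁻¹ := by
  have h1 : Summable fun m : ℕ => (((m : ℝ) + 1) ^ (3 / 2 : ℝ))⁻¹ := by
    have := (summable_nat_add_iff 1).mpr
      (Real.summable_nat_rpow_inv.mpr (show (1 : ℝ) < 3 / 2 by norm_num))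
    simpa using this
  have h2 := h1.mul_of_nonneg h1 (fun m => by positivity) (fun m => by positivity)
  set δ := min τ 1 / 2 with hδ
  have hδ0 : 0 < δ := by
    have := lt_min hτ one_pos
    positivity
  refine Summable.of_nonneg_of_le (fun x => inv_nonneg.mpr (pow_nonneg (latticePt_nonneg hτ x) 3))
    (fun x => ?_) (h2.mul_left (δ ^ 3)⁻¹)
  by_cases hx : x = (0, 0)
  · rw [hx, latticePt_zero]
    simp only [ne_eq, OfNat.ofNat_ne_zero, not_false_eq_true, zero_pow, inv_zero]
    positivity
  rw [← mul_inv, ← mul_inv]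
  refine inv_anti₀ (by positivity) ?_
  have hl := min_mul_le_latticePt hτ hx
  calc δ ^ 3 * (((x.1 : ℝ) + 1) ^ (3 / 2 : ℝ) * ((x.2 : ℝ) + 1) ^ (3 / 2 : ℝ))
      = δ ^ 3 * ((((x.1 : ℝ) + 1) * ((x.2 : ℝ) + 1)) ^ (3 / 2 : ℝ)) := by
        rw [Real.mul_rpow (by positivity) (by positivity)]
    _ ≤ δ ^ 3 * (((x.1 : ℝ) + x.2 + 1) ^ 2) ^ (3 / 2 : ℝ) := by
        gcongr
        have : (0 : ℝ) ≤ x.1 := Nat.cast_nonneg _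
        have : (0 : ℝ) ≤ x.2 := Nat.cast_nonneg _
        nlinarith [mul_nonneg ‹(0 : ℝ) ≤ x.1› ‹(0 : ℝ) ≤ x.2›]
    _ = (δ * ((x.1 : ℝ) + x.2 + 1)) ^ 3 := by
        rw [← Real.rpow_natCast _ 2, ← Real.rpow_mul (by positivity), mul_pow,
          ← Real.rpow_natCast _ 3]
        norm_num
    _ ≤ latticePt τ x ^ 3 := by gcongr

/-- The infinite product in the definition of the Barnes double gamma function. -/
def weierstrassProd (τ : ℝ) (z : ℂ) : ℂ := ∏' x : ℕ × ℕ, weierstrassE (z / latticePt τ x)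

theorem barnesG_eq (τ : ℝ) (z : ℂ) :
    barnesG z τ = z / τ * exp (aBarnes τ * z / τ + bBarnes τ * z ^ 2 / (2 * τ)) *
      weierstrassProd τ z := by
  unfold barnesG weierstrassProd
  congr 1
  refine tprod_congr fun x => ?_
  split_ifs with hx
  · rw [hx, latticePt_zero]
    simp [weierstrassE]
  · simp only [weierstrassE, latticePt, div_pow]
    push_cast
    rw [div_div, mul_comm (2 : ℂ)]

theorem norm_weierstrassE_div_sub_one_le {τ : ℝ} (hτ : 0 < τ) {z : ℂ} {R : ℝ} (hz : ‖z‖ ≤ R)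
    (x : ℕ × ℕ) :
    ‖weierstrassE (z / latticePt τ x) - 1‖ ≤
      R ^ 3 * Real.exp (R / (min τ 1 / 2) + (R / (min τ 1 / 2)) ^ 2 / 2) *
        (latticePt τ x ^ 3)⁻¹ := by
  have hR : 0 ≤ R := (norm_nonneg z).trans hz
  have hδ : 0 < min τ 1 := lt_min hτ one_pos
  by_cases hx : x = (0, 0)
  · rw [hx, latticePt_zero]
    simp [weierstrassE]
  have hp := latticePt_pos hτ hx
  have hl := min_le_latticePt hτ hx
  refine (norm_weierstrassE_sub_one_le _).trans ?_
  have e : ‖z / latticePt τ x‖ = ‖z‖ / latticePt τ x := by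
    rw [norm_div, norm_real, Real.norm_of_nonneg hp.le]
  rw [e]
  have h1 : ‖z‖ / latticePt τ x ≤ R / (min τ 1 / 2) := by gcongr
  have h0 : 0 ≤ ‖z‖ / latticePt τ x := by positivity
  calc (‖z‖ / latticePt τ x) ^ 3 * Real.exp (‖z‖ / latticePt τ x + (‖z‖ / latticePt τ x) ^ 2 / 2)
      ≤ (R / latticePt τ x) ^ 3 *
        Real.exp (R / (min τ 1 / 2) + (R / (min τ 1 / 2)) ^ 2 / 2) := by gcongr
    _ = _ := by rw [div_pow]; ring

theorem summable_norm_weierstrassE_sub_one {τ : ℝ} (hτ : 0 < τ) (z : ℂ) :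
    Summable fun x : ℕ × ℕ => ‖weierstrassE (z / latticePt τ x) - 1‖ :=
  Summable.of_nonneg_of_le (fun _ => norm_nonneg _)
    (norm_weierstrassE_div_sub_one_le hτ le_rfl) ((summable_inv_latticePt_cube hτ).mul_left _)

theorem multipliable_weierstrassE {τ : ℝ} (hτ : 0 < τ) (z : ℂ) :
    Multipliable fun x : ℕ × ℕ => weierstrassE (z / latticePt τ x) := by
  simpa using multipliable_one_add_of_summable (summable_norm_weierstrassE_sub_one hτ z)

theorem differentiable_weierstrassE : Differentiable ℂ weierstrassE :=
  fun u => (hasDerivAt_weierstrassE u).differentiableAt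

theorem differentiable_weierstrassProd {τ : ℝ} (hτ : 0 < τ) :
    Differentiable ℂ (weierstrassProd τ) := by
  intro z
  have hf : ∀ x : ℕ × ℕ, Differentiable ℂ fun w : ℂ => weierstrassE (w / latticePt τ x) :=
    fun x => differentiable_weierstrassE.comp (differentiable_id.div_const _)
  have h := Summable.hasProdLocallyUniformlyOn_one_add
    (f := fun (x : ℕ × ℕ) (w : ℂ) => weierstrassE (w / latticePt τ x) - 1)
    (Metric.isOpen_ball (x := (0 : ℂ)) (ε := ‖z‖ + 1))
    ((summable_inv_latticePt_cube hτ).mul_left _)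
    (Eventually.of_forall fun x w hw => norm_weierstrassE_div_sub_one_le hτ
      (by simpa using (mem_ball_zero_iff.mp hw).le) x)
    (fun x => ((hf x).continuous.sub continuous_const).continuousOn)
  rw [hasProdLocallyUniformlyOn_iff_tendstoLocallyUniformlyOn] at h
  have hd := h.differentiableOn (Eventually.of_forall fun s => by
    simp only [add_sub_cancel]
    exact (Differentiable.fun_finsetProd fun x _ => hf x).differentiableOn) Metric.isOpen_ball
  simp only [add_sub_cancel] at hd
  exact hd.differentiableAt (Metric.isOpen_ball.mem_nhds (by simp))

theorem weierstrassProd_ne_zero {τ : ℝ} (hτ : 0 < τ) {z : ℂ} (hz : 0 ≤ z.re) :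
    weierstrassProd τ z ≠ 0 := by
  have h := tprod_one_add_ne_zero_of_summable
    (f := fun x : ℕ × ℕ => weierstrassE (z / latticePt τ x) - 1) (fun x => ?_)
    (summable_norm_weierstrassE_sub_one hτ z)
  · simpa [weierstrassProd] using h
  · rw [add_sub_cancel]
    refine weierstrassE_ne_zero fun h0 => ?_
    have := congrArg re h0
    rw [add_re, one_re, div_ofReal_re, zero_re] at this
    have := div_nonneg hz (latticePt_nonneg hτ x)
    linarith

theorem differentiable_barnesG {τ : ℝ} (hτ : 0 < τ) : Differentiable ℂ fun z => barnesG z τ := by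
  have := differentiable_weierstrassProd hτ
  simp only [barnesG_eq]
  fun_prop

theorem barnesG_ne_zero {τ : ℝ} (hτ : 0 < τ) {z : ℂ} (hz : 0 < z.re) : barnesG z τ ≠ 0 := by
  rw [barnesG_eq]
  have h0 : z ≠ 0 := fun h => by simp [h] at hz
  have h1 : (τ : ℂ) ≠ 0 := ofReal_ne_zero.mpr hτ.ne'
  exact mul_ne_zero (mul_ne_zero (div_ne_zero h0 h1) (exp_ne_zero _))
    (weierstrassProd_ne_zero hτ hz.le)

/-- Growth comparison of a single Weierstrass factor along a segment staying away from the real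
axis. -/
theorem norm_weierstrassE_le_of_segment {l T X R : ℝ} (hl : 0 < l) (hT : 0 < T)
    (hRT : 2 * R ≤ T) {z w : ℂ}
    (hseg : ∀ r ∈ Icc (0 : ℝ) 1, T ≤ |(z + r * (w - z)).im| ∧ |(z + r * (w - z)).re| ≤ R ∧
      ‖z + r * (w - z)‖ ≤ X) :
    ‖weierstrassE (w / l)‖ ≤ ‖weierstrassE (z / l)‖ *
      Real.exp (4 * X ^ 2 * ‖w - z‖ * (l ^ 2 * (l + T))⁻¹) := by
  have hl0 : (l : ℂ) ≠ 0 := ofReal_ne_zero.mpr hl.ne'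
  set γ : ℝ → ℂ := fun r => (z + r * (w - z)) / l with hγ
  have hγd : ∀ r, HasDerivAt γ ((w - z) / l) r := by
    intro r
    have h1 : HasDerivAt (fun r : ℝ => (r : ℂ)) 1 r := ofRealCLM.hasDerivAt
    simpa using ((h1.mul_const (w - z)).const_add z).div_const (l : ℂ)
  have hd : ∀ r, HasDerivAt (fun r => weierstrassE (γ r))
      ((γ r) ^ 2 * exp (-(γ r) + (γ r) ^ 2 / 2) * ((w - z) / l)) r :=
    fun r => (hasDerivAt_weierstrassE (γ r)).comp r (hγd r)
  have hgr := norm_le_gronwallBound_of_norm_deriv_right_le (f := fun r => weierstrassE (γ r))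
    (a := 0) (b := 1) (δ := ‖weierstrassE (z / l)‖) (ε := 0)
    (K := 4 * X ^ 2 * ‖w - z‖ * (l ^ 2 * (l + T))⁻¹)
    (fun r _ => (hd r).continuousAt.continuousWithinAt) (fun r _ => (hd r).hasDerivWithinAt)
    (by simp [hγ])
    (fun r hr => by
      obtain ⟨h1, h2, h3⟩ := hseg r ⟨hr.1, hr.2.le⟩
      set u := z + r * (w - z) with hu
      have hlow : l + T ≤ 4 * ‖(l : ℂ) + u‖ := by
        have ha : T ≤ ‖(l : ℂ) + u‖ := by
          refine h1.trans ?_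
          have := abs_im_le_norm ((l : ℂ) + u)
          simpa using this
        have hb : l - R ≤ ‖(l : ℂ) + u‖ := by
          have := re_le_norm ((l : ℂ) + u)
          rw [add_re, ofReal_re] at this
          linarith [neg_abs_le u.re]
        linarith
      have hfac : weierstrassE (γ r) = (l + u) / l * exp (-(γ r) + (γ r) ^ 2 / 2) := by
        simp only [weierstrassE, hγ, ← hu]
        rw [add_div (l : ℂ) u, div_self hl0]
      rw [hfac, add_zero, norm_mul, norm_mul, norm_mul, norm_pow]
      have hg : ‖γ r‖ = ‖u‖ / l := by
        simp only [hγ, ← hu]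
        rw [norm_div, norm_real, Real.norm_of_nonneg hl.le]
      rw [hg, norm_div, norm_div, norm_real, Real.norm_of_nonneg hl.le]
      have hlT : 0 < l + T := by linarith
      have key : (‖u‖ / l) ^ 2 * (‖w - z‖ / l) ≤
          4 * X ^ 2 * ‖w - z‖ * (l ^ 2 * (l + T))⁻¹ * (‖(l : ℂ) + u‖ / l) := by
        have e1 : (‖u‖ / l) ^ 2 * (‖w - z‖ / l) =
            ‖u‖ ^ 2 * ‖w - z‖ * (l ^ 3)⁻¹ * 1 := by
          field_simp
        have e2 : 4 * X ^ 2 * ‖w - z‖ * (l ^ 2 * (l + T))⁻¹ * (‖(l : ℂ) + u‖ / l) =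
            X ^ 2 * ‖w - z‖ * (l ^ 3)⁻¹ * (4 * ‖(l : ℂ) + u‖ / (l + T)) := by
          field_simp
        rw [e1, e2]
        have : 1 ≤ 4 * ‖(l : ℂ) + u‖ / (l + T) := by
          rw [le_div_iff₀ hlT, one_mul]
          exact hlow
        gcongr
      calc _ = (‖u‖ / l) ^ 2 * (‖w - z‖ / l) * ‖exp (-(γ r) + (γ r) ^ 2 / 2)‖ := by ring
        _ ≤ _ := by
          rw [← mul_assoc]
          exact mul_le_mul_of_nonneg_right key (norm_nonneg _))
    1 ⟨zero_le_one, le_rfl⟩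
  rw [gronwallBound_ε0, sub_zero, mul_one] at hgr
  simpa [hγ] using hgr

theorem norm_le_of_hasProd_of_norm_prod_le {ι : Type*} {f g : ι → ℂ} {a b : ℂ} {c : ℝ}
    (hf : HasProd f a) (hg : HasProd g b)
    (h : ∀ s : Finset ι, ∏ i ∈ s, ‖f i‖ ≤ (∏ i ∈ s, ‖g i‖) * c) : ‖a‖ ≤ ‖b‖ * c :=
  le_of_tendsto_of_tendsto' hf.norm (hg.norm.mul_const c) h

/-- The sum controlling the logarithmic derivative of the Weierstrass product. -/
def cubicSum (τ T : ℝ) : ℝ := ∑' x : ℕ × ℕ, (latticePt τ x ^ 2 * (latticePt τ x + T))⁻¹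

theorem inv_latticePt_sq_mul_le {τ T : ℝ} (hτ : 0 < τ) (hT : 0 ≤ T) (x : ℕ × ℕ) :
    (latticePt τ x ^ 2 * (latticePt τ x + T))⁻¹ ≤ (latticePt τ x ^ 3)⁻¹ := by
  by_cases hx : x = (0, 0)
  · rw [hx, latticePt_zero]
    simp
  have hp := latticePt_pos hτ hx
  refine inv_anti₀ (by positivity) ?_
  rw [pow_succ]
  gcongr
  linarith

theorem inv_latticePt_sq_mul_nonneg {τ T : ℝ} (hτ : 0 < τ) (hT : 0 ≤ T) (x : ℕ × ℕ) :
    0 ≤ (latticePt τ x ^ 2 * (latticePt τ x + T))⁻¹ := by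
  have := latticePt_nonneg hτ x
  positivity

theorem summable_cubicSum {τ T : ℝ} (hτ : 0 < τ) (hT : 0 ≤ T) :
    Summable fun x : ℕ × ℕ => (latticePt τ x ^ 2 * (latticePt τ x + T))⁻¹ :=
  Summable.of_nonneg_of_le (inv_latticePt_sq_mul_nonneg hτ hT) (inv_latticePt_sq_mul_le hτ hT)
    (summable_inv_latticePt_cube hτ)

theorem tendsto_cubicSum {τ : ℝ} (hτ : 0 < τ) : Tendsto (cubicSum τ) atTop (𝓝 0) := by
  have hpt : ∀ x : ℕ × ℕ, Tendsto
      (fun T : ℝ => (latticePt τ x ^ 2 * (latticePt τ x + T))⁻¹) atTop (𝓝 0) := by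
    intro x
    by_cases hx : x = (0, 0)
    · rw [hx, latticePt_zero]
      simp
    have hp := latticePt_pos hτ hx
    refine tendsto_inv_atTop_zero.comp (Tendsto.const_mul_atTop (by positivity) ?_)
    exact tendsto_atTop_add_const_left _ _ tendsto_id
  have hdom : ∀ᶠ T : ℝ in atTop, ∀ x : ℕ × ℕ,
      ‖(latticePt τ x ^ 2 * (latticePt τ x + T))⁻¹‖ ≤ (latticePt τ x ^ 3)⁻¹ := by
    filter_upwards [eventually_ge_atTop 0] with T hT x
    rw [Real.norm_of_nonneg (inv_latticePt_sq_mul_nonneg hτ hT x)]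
    exact inv_latticePt_sq_mul_le hτ hT x
  have h := tendsto_tsum_of_dominated_convergence (summable_inv_latticePt_cube hτ) hpt hdom
  rwa [tsum_zero] at h

theorem norm_weierstrassProd_le_of_segment {τ T X R : ℝ} (hτ : 0 < τ) (hT : 0 < T)
    (hRT : 2 * R ≤ T) {z w : ℂ}
    (hseg : ∀ r ∈ Icc (0 : ℝ) 1, T ≤ |(z + r * (w - z)).im| ∧ |(z + r * (w - z)).re| ≤ R ∧
      ‖z + r * (w - z)‖ ≤ X) :
    ‖weierstrassProd τ w‖ ≤ ‖weierstrassProd τ z‖ *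
      Real.exp (4 * X ^ 2 * ‖w - z‖ * cubicSum τ T) := by
  refine norm_le_of_hasProd_of_norm_prod_le (multipliable_weierstrassE hτ w).hasProd
    (multipliable_weierstrassE hτ z).hasProd fun s => ?_
  have h1 : ∀ x : ℕ × ℕ, ‖weierstrassE (w / latticePt τ x)‖ ≤
      ‖weierstrassE (z / latticePt τ x)‖ * Real.exp (4 * X ^ 2 * ‖w - z‖ *
        (latticePt τ x ^ 2 * (latticePt τ x + T))⁻¹) := by
    intro x
    by_cases hx : x = (0, 0)
    · rw [hx, latticePt_zero]
      simp
    · exact norm_weierstrassE_le_of_segment (latticePt_pos hτ hx) hT hRT hseg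
  refine (Finset.prod_le_prod (fun _ _ => norm_nonneg _) fun x _ => h1 x).trans ?_
  rw [Finset.prod_mul_distrib, ← Real.exp_sum, ← Finset.mul_sum]
  gcongr
  exact (summable_cubicSum hτ hT.le).sum_le_tsum s
    fun x _ => inv_latticePt_sq_mul_nonneg hτ hT.le x

open Bornology in
theorem eventually_cobounded_linear_le_sq {K ε : ℝ} (hε : 0 < ε) :
    ∀ᶠ t : ℝ in cobounded ℝ, K * (1 + |t|) ≤ ε * t ^ 2 := by
  have h : ∀ᶠ x : ℝ in atTop, K * (1 + x) ≤ ε * x ^ 2 := by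
    filter_upwards [eventually_ge_atTop 1, eventually_ge_atTop (2 * |K| / ε)] with x h1 h2
    rw [div_le_iff₀ hε] at h2
    have h3 : K * (1 + x) ≤ |K| * (x + x) :=
      mul_le_mul (le_abs_self K) (by linarith) (by linarith) (abs_nonneg K)
    nlinarith
  filter_upwards [tendsto_norm_cobounded_atTop.eventually h] with t ht
  simpa using ht

open Bornology in
theorem eventually_cobounded_le_abs (K : ℝ) : ∀ᶠ t : ℝ in cobounded ℝ, K ≤ |t| := by
  simpa using (tendsto_norm_cobounded_atTop (E := ℝ)).eventually (eventually_ge_atTop K)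

open Bornology in
/-- Near the imaginary axis the Weierstrass product varies by a factor `exp (o(t²))`. -/
theorem eventually_weierstrassProd_comparable {τ ε : ℝ} (hτ : 0 < τ) (hε : 0 < ε) {R : ℝ}
    (hR : 0 ≤ R) :
    ∀ᶠ t : ℝ in cobounded ℝ, ∀ w : ℂ, ‖w - t * I‖ ≤ R →
      ‖weierstrassProd τ w‖ ≤ ‖weierstrassProd τ (t * I)‖ * Real.exp (ε * t ^ 2) ∧
      ‖weierstrassProd τ (t * I)‖ ≤ ‖weierstrassProd τ w‖ * Real.exp (ε * t ^ 2) := by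
  have h1 : ∀ᶠ t : ℝ in cobounded ℝ, 16 * R * cubicSum τ (|t| / 2) ≤ ε := by
    have h2 : Tendsto (fun t : ℝ => 16 * R * cubicSum τ (|t| / 2)) (cobounded ℝ) (𝓝 0) := by
      have h3 : Tendsto (fun t : ℝ => |t| / 2) (cobounded ℝ) atTop := by
        simpa using (tendsto_norm_cobounded_atTop (E := ℝ)).atTop_div_const two_pos
      simpa using ((tendsto_cubicSum hτ).comp h3).const_mul (16 * R)
    exact h2.eventually (eventually_le_nhds hε)
  filter_upwards [h1, eventually_cobounded_le_abs (4 * R + 1)] with t ht ht4 w hw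
  have hexp : 4 * (2 * |t|) ^ 2 * ‖w - t * I‖ * cubicSum τ (|t| / 2) ≤ ε * t ^ 2 := by
    have hc : 0 ≤ cubicSum τ (|t| / 2) :=
      tsum_nonneg fun x => inv_latticePt_sq_mul_nonneg hτ (by positivity) x
    calc _ ≤ 4 * (2 * |t|) ^ 2 * R * cubicSum τ (|t| / 2) := by gcongr
      _ = 16 * R * cubicSum τ (|t| / 2) * t ^ 2 := by rw [mul_pow, sq_abs]; ring
      _ ≤ _ := by gcongr
  have hball : ∀ u : ℂ, ‖u - t * I‖ ≤ R → |t| / 2 ≤ |u.im| ∧ |u.re| ≤ R ∧ ‖u‖ ≤ 2 * |t| := by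
    intro u hu
    refine ⟨?_, ?_, ?_⟩
    · have := (abs_im_le_norm (u - t * I)).trans hu
      simp only [sub_im, mul_im, ofReal_re, I_im, mul_one, ofReal_im, I_re, mul_zero,
        add_zero] at this
      have h5 := abs_sub_abs_le_abs_sub t u.im
      rw [abs_sub_comm] at h5
      linarith
    · have := (abs_re_le_norm (u - t * I)).trans hu
      simpa using this
    · have h5 := norm_le_norm_add_norm_sub' u (t * I)
      have h6 : ‖(t * I : ℂ)‖ = |t| := by simp
      rw [h6] at h5
      linarith
  have hcx := convex_closedBall (t * I : ℂ) R
  have hmem : ∀ z' w' : ℂ, ‖z' - t * I‖ ≤ R → ‖w' - t * I‖ ≤ R →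
      ∀ r ∈ Icc (0 : ℝ) 1, ‖z' + r * (w' - z') - t * I‖ ≤ R := by
    intro z' w' hz' hw' r hr
    have := hcx.add_smul_sub_mem (mem_closedBall_iff_norm.mpr hz') (mem_closedBall_iff_norm.mpr hw') hr
    rw [mem_closedBall_iff_norm] at this
    simpa using this
  have hT : 0 < |t| / 2 := by linarith
  have hI : ‖(t * I : ℂ) - t * I‖ ≤ R := by simpa using hR
  constructor
  · refine (norm_weierstrassProd_le_of_segment (X := 2 * |t|) (R := R) hτ hT (by linarith)
      (fun r hr => hball _ (hmem _ _ hI hw r hr))).trans ?_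
    gcongr
  · refine (norm_weierstrassProd_le_of_segment (X := 2 * |t|) (R := R) hτ hT (by linarith)
      (fun r hr => hball _ (hmem _ _ hw hI r hr))).trans ?_
    rw [norm_sub_rev]
    gcongr

theorem norm_weierstrassProd_neg_mul_I {τ : ℝ} (hτ : 0 < τ) (t : ℝ) :
    ‖weierstrassProd τ ((-t : ℝ) * I)‖ = ‖weierstrassProd τ (t * I)‖ := by
  unfold weierstrassProd
  rw [(multipliable_weierstrassE hτ _).norm_tprod, (multipliable_weierstrassE hτ _).norm_tprod]
  refine tprod_congr fun x => ?_
  rw [← norm_weierstrassE_conj (t * I / latticePt τ x)]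
  simp

theorem norm_weierstrassE_mul_I_sq (v : ℝ) :
    ‖weierstrassE (v * I)‖ ^ 2 = (1 + v ^ 2) * Real.exp (-v ^ 2) := by
  rw [weierstrassE, norm_mul, mul_pow, norm_exp, ← Real.exp_nat_mul, ← normSq_eq_norm_sq]
  congr 2
  · simp [normSq_apply]
    ring
  · have : (-(v * I : ℂ) + (v * I) ^ 2 / 2) = ((-v ^ 2 / 2 : ℝ) : ℂ) + (-v : ℝ) * I := by
      rw [mul_pow, I_sq]
      push_cast
      ring
    rw [this]
    simp only [add_re, ofReal_re, mul_re, I_re, mul_zero, ofReal_im, I_im, mul_one]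
    push_cast
    ring

theorem norm_weierstrassE_mul_I_le_one (v : ℝ) : ‖weierstrassE (v * I)‖ ≤ 1 := by
  refine (sq_le_one_iff₀ (norm_nonneg _)).mp ?_
  rw [norm_weierstrassE_mul_I_sq]
  calc (1 + v ^ 2) * Real.exp (-v ^ 2) ≤ Real.exp (v ^ 2) * Real.exp (-v ^ 2) := by
        gcongr
        linarith [Real.add_one_le_exp (v ^ 2)]
    _ = 1 := by rw [← Real.exp_add, add_neg_cancel, Real.exp_zero]

theorem norm_weierstrassE_mul_I_le_exp {v : ℝ} (hv : 2 ≤ |v|) :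
    ‖weierstrassE (v * I)‖ ≤ Real.exp (-(v ^ 2 / 4)) := by
  refine (sq_le_sq₀ (norm_nonneg _) (Real.exp_pos _).le).mp ?_
  rw [norm_weierstrassE_mul_I_sq, ← Real.exp_nat_mul]
  have h4 : 4 ≤ v ^ 2 := by
    rw [← sq_abs]
    nlinarith
  have h := Real.quadratic_le_exp_of_nonneg (x := v ^ 2 / 2) (by positivity)
  calc (1 + v ^ 2) * Real.exp (-v ^ 2) ≤ Real.exp (v ^ 2 / 2) * Real.exp (-v ^ 2) := by
        gcongr
        nlinarith
    _ = _ := by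
        rw [← Real.exp_add]
        push_cast
        ring_nf

theorem not_summable_inv_latticePt_sq {τ : ℝ} (hτ : 0 < τ) :
    ¬ Summable fun x : ℕ × ℕ => (latticePt τ x ^ 2)⁻¹ := by
  intro h
  have h1 : Summable fun m : ℕ => ((m : ℝ) * (τ + 1) ^ 2)⁻¹ := by
    refine Summable.of_nonneg_of_le (fun m => by positivity) (fun m => ?_) h.prod
    have h2 := (h.prod_factor m).sum_le_tsum (Finset.Icc 1 m) (fun n _ => by positivity)
    refine le_trans ?_ h2
    have h3 : ∀ n ∈ Finset.Icc 1 m, (((m : ℝ) * (τ + 1)) ^ 2)⁻¹ ≤ (latticePt τ (m, n) ^ 2)⁻¹ := by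
      intro n hn
      rw [Finset.mem_Icc] at hn
      have hn1 : (1 : ℝ) ≤ n := by exact_mod_cast hn.1
      have hnm : (n : ℝ) ≤ m := by exact_mod_cast hn.2
      have hm : (0 : ℝ) < m := by linarith
      unfold latticePt
      refine inv_anti₀ (by positivity) ?_
      gcongr
      simp only
      linarith
    refine le_trans ?_ (Finset.sum_le_sum h3)
    rw [Finset.sum_const, Nat.card_Icc, Nat.add_sub_cancel, nsmul_eq_mul]
    rcases Nat.eq_zero_or_pos m with hm | hm
    · simp [hm]
    · have hm' : (0 : ℝ) < m := by exact_mod_cast hm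
      apply le_of_eq
      field_simp
  refine Real.not_summable_natCast_inv ?_
  refine (h1.mul_right ((τ + 1) ^ 2)).congr fun m => ?_
  rw [mul_inv, mul_assoc, inv_mul_cancel₀ (by positivity), mul_one]

open Bornology in
/-- Super-Gaussian decay of the Weierstrass product on the imaginary axis. -/
theorem eventually_norm_weierstrassProd_le {τ : ℝ} (hτ : 0 < τ) (M : ℝ) :
    ∀ᶠ t : ℝ in cobounded ℝ, ‖weierstrassProd τ (t * I)‖ ≤ Real.exp (-(M * t ^ 2)) := by
  obtain ⟨S, hS⟩ : ∃ S : Finset (ℕ × ℕ), 4 * M < ∑ x ∈ S, (latticePt τ x ^ 2)⁻¹ := by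
    by_contra! hcon
    exact not_summable_inv_latticePt_sq hτ
      (summable_of_sum_le (fun x => by simp only [Pi.zero_apply]; positivity) hcon)
  have hbig : ∀ᶠ t : ℝ in cobounded ℝ, ∀ x ∈ S, 2 * latticePt τ x ≤ |t| :=
    (Finset.eventually_all S).mpr fun x _ => eventually_cobounded_le_abs _
  filter_upwards [hbig] with t ht
  have hfac : ∀ x : ℕ × ℕ, (t * I : ℂ) / latticePt τ x = ((t / latticePt τ x : ℝ) : ℂ) * I := by
    intro x
    push_cast
    ring
  have hle : ‖weierstrassProd τ (t * I)‖ ≤ ∏ x ∈ S, ‖weierstrassE (t * I / latticePt τ x)‖ := by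
    refine le_of_tendsto (multipliable_weierstrassE hτ (t * I)).hasProd.norm ?_
    filter_upwards [eventually_ge_atTop S] with U hU
    exact Finset.prod_le_prod_of_subset_of_le_one hU (fun _ _ => norm_nonneg _)
      (fun x _ _ => by rw [hfac]; exact norm_weierstrassE_mul_I_le_one _)
  refine hle.trans ?_
  have h1 : ∀ x ∈ S, ‖weierstrassE (t * I / latticePt τ x)‖ ≤
      Real.exp (-(t ^ 2 / 4 * (latticePt τ x ^ 2)⁻¹)) := by
    intro x hx
    by_cases hx0 : x = (0, 0)
    · rw [hx0, latticePt_zero]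
      simp [weierstrassE]
    have hp := latticePt_pos hτ hx0
    rw [hfac]
    refine (norm_weierstrassE_mul_I_le_exp ?_).trans_eq ?_
    · rw [abs_div, abs_of_pos hp, le_div_iff₀ hp]
      exact ht x hx
    · rw [div_pow]
      ring_nf
  refine (Finset.prod_le_prod (fun _ _ => norm_nonneg _) h1).trans ?_
  rw [← Real.exp_sum, Real.exp_le_exp, Finset.sum_neg_distrib, ← Finset.mul_sum, neg_le_neg_iff]
  nlinarith [sq_nonneg t]


/-- The modulus of `barnesG` along the imaginary axis, up to factors `exp (o(t²))`. -/
def barnesAxis (τ t : ℝ) : ℝ :=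
  ‖weierstrassProd τ (t * I)‖ * Real.exp (-((bBarnes τ).re * t ^ 2 / (2 * τ)))

theorem barnesAxis_pos {τ : ℝ} (hτ : 0 < τ) (t : ℝ) : 0 < barnesAxis τ t :=
  mul_pos (norm_pos_iff.mpr (weierstrassProd_ne_zero hτ (by simp))) (Real.exp_pos _)

theorem barnesAxis_neg {τ : ℝ} (hτ : 0 < τ) (t : ℝ) : barnesAxis τ (-t) = barnesAxis τ t := by
  rw [barnesAxis, norm_weierstrassProd_neg_mul_I hτ, neg_sq, barnesAxis]

theorem norm_barnesG_eq {τ : ℝ} (hτ : 0 < τ) (w : ℂ) (t : ℝ) :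
    ‖barnesG w τ‖ = ‖w‖ / τ *
      (Real.exp (-((bBarnes τ).re * t ^ 2 / (2 * τ))) *
        Real.exp ((aBarnes τ * w + bBarnes τ * ((w - t * I) * (w + t * I)) / 2) / τ : ℂ).re) *
      ‖weierstrassProd τ w‖ := by
  rw [barnesG_eq, norm_mul, norm_mul, norm_div, norm_real, Real.norm_of_nonneg hτ.le, norm_exp,
    ← Real.exp_add]
  congr 3
  have h : aBarnes τ * w / τ + bBarnes τ * w ^ 2 / (2 * τ) =
      ((-(t ^ 2 / (2 * τ)) : ℝ) : ℂ) * bBarnes τ +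
      (aBarnes τ * w + bBarnes τ * ((w - t * I) * (w + t * I)) / 2) / τ := by
    have hτ' : (τ : ℂ) ≠ 0 := ofReal_ne_zero.mpr hτ.ne'
    have hI : (w - t * I) * (w + t * I) = w ^ 2 + t ^ 2 := by
      linear_combination (-(t : ℂ) ^ 2) * I_sq
    rw [hI]
    push_cast
    field_simp
    ring
  rw [h, add_re, re_ofReal_mul]
  ring

open Bornology in
/-- Near the imaginary axis `barnesG` is comparable to `barnesAxis` up to `exp (o(t²))`. -/
theorem eventually_barnesG_comparable {τ ε R : ℝ} (hτ : 0 < τ) (hε : 0 < ε) (hR : 0 ≤ R) :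
    ∀ᶠ t : ℝ in cobounded ℝ, ∀ w : ℂ, ‖w - t * I‖ ≤ R →
      ‖barnesG w τ‖ ≤ barnesAxis τ t * Real.exp (ε * t ^ 2) ∧
      barnesAxis τ t * Real.exp (-(ε * t ^ 2)) ≤ ‖barnesG w τ‖ := by
  set A := aBarnes τ
  set B := bBarnes τ
  set K := ((‖A‖ + 1) * (R + 1) + ‖B‖ * (R * (R + 2)) / 2) / τ with hK
  filter_upwards [eventually_weierstrassProd_comparable hτ (half_pos hε) hR,
    eventually_cobounded_linear_le_sq (K := K) (div_pos hε (by norm_num : (0 : ℝ) < 4)),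
    eventually_cobounded_le_abs (R + τ)] with t hW hlin ht w hw
  obtain ⟨hW₁, hW₂⟩ := hW w hw
  have ht0 : 0 ≤ |t| := abs_nonneg t
  have htI : ‖(t * I : ℂ)‖ = |t| := by simp
  have hwu : ‖w‖ ≤ (R + 1) * (1 + |t|) := by
    have := norm_le_norm_add_norm_sub' w (t * I)
    rw [htI] at this
    nlinarith
  have hwl : τ ≤ ‖w‖ := by
    have := norm_le_norm_add_norm_sub' (t * I) w
    rw [htI, norm_sub_rev] at this
    linarith
  have hwp : ‖w + t * I‖ ≤ (R + 2) * (1 + |t|) := by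
    have : w + t * I = (w - t * I) + 2 * (t * I) := by ring
    rw [this]
    refine (norm_add_le _ _).trans ?_
    rw [norm_mul, htI, RCLike.norm_ofNat]
    nlinarith
  set E := (A * w + B * ((w - t * I) * (w + t * I)) / 2) / τ with hE
  have hEn : ‖E‖ ≤ ε / 4 * t ^ 2 - (R + 1) * (1 + |t|) / τ := by
    have h1 : ‖A * w + B * ((w - t * I) * (w + t * I)) / 2‖ ≤
        ‖A‖ * ((R + 1) * (1 + |t|)) + ‖B‖ * (R * ((R + 2) * (1 + |t|))) / 2 := by
      refine (norm_add_le _ _).trans ?_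
      rw [norm_mul, norm_div, norm_mul, norm_mul, RCLike.norm_ofNat]
      gcongr
    have h2 : (‖A‖ * ((R + 1) * (1 + |t|)) + ‖B‖ * (R * ((R + 2) * (1 + |t|))) / 2) / τ =
        K * (1 + |t|) - (R + 1) * (1 + |t|) / τ := by
      rw [hK]
      field_simp
      ring
    rw [hE, norm_div, norm_real, Real.norm_of_nonneg hτ.le]
    calc _ ≤ _ := div_le_div_of_nonneg_right h1 hτ.le
      _ = _ := h2
      _ ≤ _ := by linarith
  have hEre := abs_le.mp (abs_re_le_norm E)
  have hpos : 0 ≤ (R + 1) * (1 + |t|) / τ := by positivity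
  rw [norm_barnesG_eq hτ w t, barnesAxis]
  set P := Real.exp (-((bBarnes τ).re * t ^ 2 / (2 * τ)))
  have hP : 0 < P := Real.exp_pos _
  constructor
  · have h1 : ‖w‖ / τ ≤ Real.exp ((R + 1) * (1 + |t|) / τ) := by
      refine le_trans ?_ (Real.add_one_le_exp _)
      have : ‖w‖ / τ ≤ (R + 1) * (1 + |t|) / τ := by gcongr
      linarith
    have h2 : Real.exp E.re ≤
        Real.exp (ε / 2 * t ^ 2 - (R + 1) * (1 + |t|) / τ) := by
      rw [Real.exp_le_exp]
      nlinarith [sq_nonneg t]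
    calc _ ≤ Real.exp ((R + 1) * (1 + |t|) / τ) *
          (P * Real.exp (ε / 2 * t ^ 2 - (R + 1) * (1 + |t|) / τ)) *
          (‖weierstrassProd τ (t * I)‖ * Real.exp (ε / 2 * t ^ 2)) := by gcongr
      _ = ‖weierstrassProd τ (t * I)‖ * P * (Real.exp ((R + 1) * (1 + |t|) / τ) *
          Real.exp (ε / 2 * t ^ 2 - (R + 1) * (1 + |t|) / τ) * Real.exp (ε / 2 * t ^ 2)) := by
        ring
      _ = _ := by
        rw [← Real.exp_add, ← Real.exp_add]
        ring_nf
  · have h1 : 1 ≤ ‖w‖ / τ := by rwa [le_div_iff₀ hτ, one_mul]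
    have h2 : Real.exp (-(ε / 2 * t ^ 2)) ≤ Real.exp E.re := by
      rw [Real.exp_le_exp]
      nlinarith [sq_nonneg t]
    calc _ ≤ ‖weierstrassProd τ w‖ * Real.exp (ε / 2 * t ^ 2) * P *
          Real.exp (-(ε * t ^ 2)) := by gcongr
      _ = 1 * (P * (Real.exp (ε / 2 * t ^ 2) * Real.exp (-(ε * t ^ 2)))) *
          ‖weierstrassProd τ w‖ := by ring
      _ = 1 * (P * Real.exp (-(ε / 2 * t ^ 2))) * ‖weierstrassProd τ w‖ := by
        rw [← Real.exp_add]
        ring_nf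
      _ ≤ _ := by gcongr

open Bornology in
theorem eventually_barnesAxis_le {τ : ℝ} (hτ : 0 < τ) (M : ℝ) :
    ∀ᶠ t : ℝ in cobounded ℝ, barnesAxis τ t ≤ Real.exp (-(M * t ^ 2)) := by
  filter_upwards [eventually_norm_weierstrassProd_le hτ (M - (bBarnes τ).re / (2 * τ))] with t ht
  calc _ ≤ Real.exp (-((M - (bBarnes τ).re / (2 * τ)) * t ^ 2)) *
        Real.exp (-((bBarnes τ).re * t ^ 2 / (2 * τ))) := by
        unfold barnesAxis
        gcongr
    _ = _ := by
      rw [← Real.exp_add]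
      ring_nf

theorem Fin.prod_ite_val_lt {q m : ℕ} (hm : m ≤ q) (U : ℝ) :
    ∏ j : Fin q, (if (j : ℕ) < m then U else 1) = U ^ m := by
  rw [Fin.prod_univ_eq_prod_range (fun j => if j < m then U else 1) q,
    ← Finset.prod_subset (Finset.range_subset_range.mpr hm)
      (fun x _ hx => if_neg (by simpa using hx)),
    Finset.prod_congr rfl fun x hx => if_pos (Finset.mem_range.mp hx), Finset.prod_const,
    Finset.card_range]

theorem Fin.prod_ite_le_val {q m : ℕ} (hm : m ≤ q) {U : ℝ} (hU : 0 < U) :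
    ∏ j : Fin q, (if m ≤ (j : ℕ) then U else 1) = U ^ (q - m) := by
  have h : (∏ j : Fin q, (if (j : ℕ) < m then U else 1)) *
      ∏ j : Fin q, (if m ≤ (j : ℕ) then U else 1) = U ^ q := by
    rw [← Finset.prod_mul_distrib, Finset.prod_congr rfl (g := fun _ => U), Finset.prod_const,
      Finset.card_univ, Fintype.card_fin]
    intro j _
    by_cases hj : (j : ℕ) < m
    · simp [hj, not_le.mpr hj]
    · simp [hj, not_lt.mp hj]
  rw [Fin.prod_ite_val_lt hm] at h
  have h2 : U ^ q = U ^ m * U ^ (q - m) := by rw [← pow_add, Nat.add_sub_cancel' hm]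
  exact mul_left_cancel₀ (pow_pos hU m).ne' (h.trans h2)

theorem norm_prod_ite_le {ι : Type*} [Fintype ι] (P : ι → Prop) [DecidablePred P] {f : ι → ℂ}
    {U : ℝ} (h : ∀ j, ‖f j‖ ≤ U) :
    ‖∏ j, (if P j then f j else 1)‖ ≤ ∏ j, (if P j then U else 1) := by
  rw [norm_prod]
  refine Finset.prod_le_prod (fun _ _ => norm_nonneg _) fun j _ => ?_
  split_ifs
  · exact h j
  · simp

theorem le_norm_prod_ite {ι : Type*} [Fintype ι] (P : ι → Prop) [DecidablePred P] {f : ι → ℂ}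
    {L : ℝ} (hL : 0 ≤ L) (h : ∀ j, L ≤ ‖f j‖) :
    ∏ j, (if P j then L else 1) ≤ ‖∏ j, (if P j then f j else 1)‖ := by
  rw [norm_prod]
  refine Finset.prod_le_prod (fun j _ => by split_ifs <;> positivity) fun j _ => ?_
  split_ifs
  · exact h j
  · simp

open Bornology in
theorem eventually_norm_calG_le {τ ε : ℝ} (hτ : 0 < τ) (hε : 0 < ε) {m n p q N : ℕ}
    (hm : m ≤ q) (hn : n ≤ p) (hN : paramN m n p q = N) (a : Fin p → ℂ) (b : Fin q → ℂ)
    (σ₁ σ₂ : ℝ) :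
    ∀ᶠ t : ℝ in cobounded ℝ, ∀ z : ℂ, z.im = t → σ₁ ≤ z.re → z.re ≤ σ₂ →
      ‖calG m n a b z τ‖ ≤ barnesAxis τ t ^ N * Real.exp (ε * (p + q) * t ^ 2) := by
  set R : ℝ := ∑ j, ‖a j‖ + ∑ j, ‖b j‖ + 1 + τ + |σ₁| + |σ₂|
  have hsa : 0 ≤ ∑ j, ‖a j‖ := Finset.sum_nonneg fun _ _ => norm_nonneg _
  have hsb : 0 ≤ ∑ j, ‖b j‖ := Finset.sum_nonneg fun _ _ => norm_nonneg _
  have hR : 0 ≤ R := by positivity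
  have ha : ∀ j, ‖a j‖ ≤ ∑ j, ‖a j‖ := fun j =>
    Finset.single_le_sum (f := fun j => ‖a j‖) (fun _ _ => norm_nonneg _) (Finset.mem_univ j)
  have hb : ∀ j, ‖b j‖ ≤ ∑ j, ‖b j‖ := fun j =>
    Finset.single_le_sum (f := fun j => ‖b j‖) (fun _ _ => norm_nonneg _) (Finset.mem_univ j)
  have hcmp := eventually_barnesG_comparable (R := R) hτ hε hR
  filter_upwards [hcmp, (tendsto_neg_cobounded (E := ℝ)).eventually hcmp] with t hp hm' z hzt h1 h2
  rw [barnesAxis_neg hτ] at hm'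
  simp only [neg_sq] at hm'
  set B := barnesAxis τ t
  have hB : 0 < B := barnesAxis_pos hτ t
  set U := B * Real.exp (ε * t ^ 2) with hU
  set L := B * Real.exp (-(ε * t ^ 2)) with hL
  have hU0 : 0 < U := by positivity
  have hL0 : 0 < L := by positivity
  have hre : |z.re| ≤ |σ₁| + |σ₂| := by
    rw [abs_le]
    constructor
    · linarith [neg_abs_le σ₁, abs_nonneg σ₂]
    · linarith [le_abs_self σ₂, abs_nonneg σ₁]
  have hz : z = z.re + t * I := by rw [← hzt, re_add_im]
  have hsubp : ∀ β : ℂ, ‖β‖ ≤ ∑ j, ‖a j‖ + ∑ j, ‖b j‖ →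
      ‖1 + τ - β + z - t * I‖ ≤ R := by
    intro β hβ
    have : 1 + τ - β + z - t * I = (((1 + τ + z.re : ℝ)) : ℂ) - β := by
      conv_lhs => rw [hz]
      push_cast
      ring
    rw [this]
    refine (norm_sub_le _ _).trans ?_
    rw [norm_real]
    have := abs_add_le (1 + τ) z.re
    rw [abs_of_pos (by linarith : 0 < 1 + τ)] at this
    rw [Real.norm_eq_abs]
    linarith
  have hsubm : ∀ β : ℂ, ‖β‖ ≤ ∑ j, ‖a j‖ + ∑ j, ‖b j‖ →
      ‖β - z - (-t : ℝ) * I‖ ≤ R := by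
    intro β hβ
    have : β - z - (-t : ℝ) * I = β - (z.re : ℂ) := by
      conv_lhs => rw [hz]
      push_cast
      ring
    rw [this]
    refine (norm_sub_le _ _).trans ?_
    rw [norm_real, Real.norm_eq_abs]
    linarith
  have ha' : ∀ j, ‖a j‖ ≤ ∑ j, ‖a j‖ + ∑ j, ‖b j‖ := fun j => by linarith [ha j]
  have hb' : ∀ j, ‖b j‖ ≤ ∑ j, ‖a j‖ + ∑ j, ‖b j‖ := fun j => by linarith [hb j]
  have n1 := norm_prod_ite_le (fun j : Fin q => (j : ℕ) < m)
    fun j => (hm' _ (hsubm _ (hb' j))).1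
  have n2 := norm_prod_ite_le (fun j : Fin p => (j : ℕ) < n)
    fun j => (hp _ (hsubp _ (ha' j))).1
  have d1 := le_norm_prod_ite (fun j : Fin q => m ≤ (j : ℕ)) hL0.le
    fun j => (hp _ (hsubp _ (hb' j))).2
  have d2 := le_norm_prod_ite (fun j : Fin p => n ≤ (j : ℕ)) hL0.le
    fun j => (hm' _ (hsubm _ (ha' j))).2
  rw [Fin.prod_ite_val_lt hm] at n1
  rw [Fin.prod_ite_val_lt hn] at n2
  rw [Fin.prod_ite_le_val hm hL0] at d1
  rw [Fin.prod_ite_le_val hn hL0] at d2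
  have hcount : m + n = ((q - m) + (p - n)) + N := by
    unfold paramN at hN
    omega
  have hpq : (m + n) + ((q - m) + (p - n)) = p + q := by omega
  rw [calG, norm_div, norm_mul, norm_mul]
  calc _ ≤ (U ^ m * U ^ n) / (L ^ (q - m) * L ^ (p - n)) := by gcongr
    _ = U ^ (m + n) / L ^ ((q - m) + (p - n)) := by rw [pow_add, pow_add]
    _ = B ^ N * (Real.exp (ε * t ^ 2) ^ (m + n) *
        Real.exp (ε * t ^ 2) ^ ((q - m) + (p - n))) := by
      rw [hU, hL, mul_pow, mul_pow, Real.exp_neg, inv_pow]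
      nth_rw 1 [hcount]
      rw [pow_add B]
      field_simp
    _ = _ := by
      rw [← pow_add, hpq, ← Real.exp_nat_mul]
      congr 2
      push_cast
      ring

theorem differentiableAt_calG {τ : ℝ} (hτ : 0 < τ) (m n : ℕ) {p q : ℕ} (a : Fin p → ℂ)
    (b : Fin q → ℂ) {z : ℂ} (hb : ∀ j : Fin q, m ≤ (j : ℕ) → (b j).re - τ - 1 < z.re)
    (ha : ∀ k : Fin p, n ≤ (k : ℕ) → z.re < (a k).re) :
    DifferentiableAt ℂ (fun s => calG m n a b s τ) z := by
  have hG := differentiable_barnesG hτ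
  have hd : ∀ {k : ℕ} (P : Fin k → Prop) [DecidablePred P] (f : Fin k → ℂ → ℂ),
      (∀ j, Differentiable ℂ (f j)) →
      DifferentiableAt ℂ (fun s => ∏ j, if P j then barnesG (f j s) τ else 1) z := by
    intro k P _ f hf
    refine DifferentiableAt.fun_finsetProd fun j _ => ?_
    by_cases hP : P j
    · simp only [hP, if_true]
      exact (hG.comp (hf j)) z
    · simp only [hP, if_false]
      exact differentiableAt_const _
  refine DifferentiableAt.div (DifferentiableAt.mul (hd _ _ fun j => ?_) (hd _ _ fun j => ?_))
    (DifferentiableAt.mul (hd _ _ fun j => ?_) (hd _ _ fun j => ?_)) ?_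
  · fun_prop
  · fun_prop
  · fun_prop
  · fun_prop
  · refine mul_ne_zero (Finset.prod_ne_zero_iff.mpr fun j _ => ?_)
      (Finset.prod_ne_zero_iff.mpr fun j _ => ?_)
    · split_ifs with h
      · refine barnesG_ne_zero hτ ?_
        have := hb j h
        simp only [add_re, sub_re, one_re, ofReal_re]
        linarith
      · exact one_ne_zero
    · split_ifs with h
      · refine barnesG_ne_zero hτ ?_
        have := ha j h
        simp only [sub_re]
        linarith
      · exact one_ne_zero

open Bornology in
theorem exists_barnesAxis_pow_le {τ x : ℝ} (hτ : 0 < τ) {N : ℕ} (h : 0 < N ∨ 0 < x) :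
    ∃ κ > 0, ∀ᶠ t : ℝ in cobounded ℝ, barnesAxis τ t ^ N ≤ Real.exp ((x - 3 * κ) * t ^ 2) := by
  rcases Nat.eq_zero_or_pos N with rfl | hN
  · have hx : 0 < x := h.resolve_left (lt_irrefl 0)
    refine ⟨x / 3, by positivity, Eventually.of_forall fun t => ?_⟩
    rw [pow_zero]
    refine Real.one_le_exp ?_
    ring_nf
    exact le_rfl
  · refine ⟨1, one_pos, ?_⟩
    filter_upwards [eventually_barnesAxis_le hτ (|x| + 3)] with t ht
    have h1 : barnesAxis τ t ≤ 1 := ht.trans (Real.exp_le_one_iff.mpr (by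
      have : 0 ≤ (|x| + 3) * t ^ 2 := by positivity
      linarith))
    refine (pow_le_of_le_one (barnesAxis_pos hτ t).le h1 hN.ne').trans (ht.trans ?_)
    rw [Real.exp_le_exp]
    nlinarith [neg_abs_le x, sq_nonneg t]

theorem norm_exp_const_mul_sq_le (A z : ℂ) :
    ‖exp (A * z ^ 2)‖ ≤
      Real.exp (-(A.re * z.im ^ 2) + ‖A‖ * (|z.re| * (|z.re| + 2)) * (1 + |z.im|)) := by
  rw [norm_exp, Real.exp_le_exp]
  have h : A * z ^ 2 = ((-z.im ^ 2 : ℝ) : ℂ) * A + A * ((z.re : ℂ) * (z.re + 2 * (z.im * I))) := by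
    conv_lhs => rw [← re_add_im z]
    push_cast
    linear_combination (A * (z.im : ℂ) ^ 2) * I_sq
  have h2 : ‖A * ((z.re : ℂ) * (z.re + 2 * (z.im * I)))‖ ≤
      ‖A‖ * (|z.re| * (|z.re| + 2)) * (1 + |z.im|) := by
    have h3 : ‖(z.re + 2 * (z.im * I) : ℂ)‖ ≤ (|z.re| + 2) * (1 + |z.im|) := by
      refine (norm_add_le _ _).trans ?_
      simp only [norm_mul, norm_real, Real.norm_eq_abs, norm_I, mul_one, RCLike.norm_ofNat]
      nlinarith [mul_nonneg (abs_nonneg z.re) (abs_nonneg z.im)]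
    rw [norm_mul, norm_mul, norm_real, Real.norm_eq_abs, mul_assoc, mul_assoc]
    gcongr
  rw [h, add_re, re_ofReal_mul]
  linarith [re_le_norm (A * ((z.re : ℂ) * (z.re + 2 * (z.im * I))))]

open Bornology in
theorem exists_gaussian_bound {τ : ℝ} (hτ : 0 < τ) (A : ℂ) {m n p q : ℕ}
    (hm : m ≤ q) (hn : n ≤ p) (a : Fin p → ℂ) (b : Fin q → ℂ)
    (hcase : 0 < paramN m n p q ∨ (paramN m n p q = 0 ∧ 0 < A.re)) {σ₁ σ₂ : ℝ}
    (hb : ∀ j : Fin q, m ≤ (j : ℕ) → (b j).re - τ - 1 < σ₁)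
    (ha : ∀ k : Fin p, n ≤ (k : ℕ) → σ₂ < (a k).re) :
    ∃ κ > 0, ∃ C : ℝ, ∀ z : ℂ, σ₁ ≤ z.re → z.re ≤ σ₂ →
      ‖exp (A * z ^ 2) * calG m n a b z τ‖ ≤ C * Real.exp (-κ * z.im ^ 2) := by
  obtain ⟨N, hN⟩ := Int.eq_ofNat_of_zero_le (hcase.elim le_of_lt fun h => h.1.ge)
  obtain ⟨κ, hκ, hax⟩ := exists_barnesAxis_pow_le (x := A.re) (N := N) hτ
    (hcase.imp (fun h => Int.natCast_pos.mp (hN ▸ h)) And.right)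
  refine ⟨κ, hκ, ?_⟩
  set S : ℝ := |σ₁| + |σ₂| with hS
  have hpq : (0 : ℝ) < p + q + 1 := by positivity
  have hcal := eventually_norm_calG_le hτ (div_pos hκ hpq) hm hn hN a b σ₁ σ₂
  have hev : ∀ᶠ t : ℝ in cobounded ℝ, ∀ z : ℂ, z.im = t → σ₁ ≤ z.re → z.re ≤ σ₂ →
      ‖exp (A * z ^ 2) * calG m n a b z τ‖ ≤ Real.exp (-κ * z.im ^ 2) := by
    filter_upwards [hcal, hax,
      eventually_cobounded_linear_le_sq (K := ‖A‖ * (S * (S + 2))) hκ] with t h1 h2 h3 z hzt hz1 hz2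
    have hre : |z.re| ≤ S := by
      rw [abs_le]
      constructor
      · linarith [neg_abs_le σ₁, abs_nonneg σ₂]
      · linarith [le_abs_self σ₂, abs_nonneg σ₁]
    have h4 := h1 z hzt hz1 hz2
    have h5 := norm_exp_const_mul_sq_le A z
    rw [hzt] at h5 ⊢
    have h6 : κ / (p + q + 1) * (p + q) * t ^ 2 ≤ κ * t ^ 2 := by
      refine mul_le_mul_of_nonneg_right ?_ (sq_nonneg t)
      rw [div_mul_eq_mul_div, div_le_iff₀ hpq]
      nlinarith
    have h7 : ‖A‖ * (|z.re| * (|z.re| + 2)) * (1 + |t|) ≤ ‖A‖ * (S * (S + 2)) * (1 + |t|) := by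
      gcongr
    rw [norm_mul]
    calc _ ≤ Real.exp (-(A.re * t ^ 2) + κ * t ^ 2) *
          (Real.exp ((A.re - 3 * κ) * t ^ 2) * Real.exp (κ * t ^ 2)) := by
          refine mul_le_mul (h5.trans (Real.exp_le_exp.mpr (by linarith))) (h4.trans ?_)
            (norm_nonneg _) (Real.exp_pos _).le
          gcongr
      _ = _ := by
        rw [← Real.exp_add, ← Real.exp_add]
        ring_nf
  obtain ⟨T, hT⟩ : ∃ T : ℝ, ∀ t : ℝ, T ≤ |t| → ∀ z : ℂ, z.im = t → σ₁ ≤ z.re → z.re ≤ σ₂ →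
      ‖exp (A * z ^ 2) * calG m n a b z τ‖ ≤ Real.exp (-κ * z.im ^ 2) := by
    rw [← comap_norm_atTop, eventually_comap] at hev
    obtain ⟨T, hT⟩ := eventually_atTop.mp hev
    exact ⟨T, fun t ht => hT |t| ht t rfl⟩
  have hcont : ContinuousOn (fun z => exp (A * z ^ 2) * calG m n a b z τ)
      (Icc σ₁ σ₂ ×ℂ Icc (-T) T) := by
    intro z hz
    rw [mem_reProdIm] at hz
    refine ContinuousAt.continuousWithinAt (ContinuousAt.mul (by fun_prop) ?_)
    exact (differentiableAt_calG hτ m n a b (fun j hj => (hb j hj).trans_le hz.1.1)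
      (fun k hk => hz.1.2.trans_lt (ha k hk))).continuousAt
  obtain ⟨C, hC⟩ := (isCompact_Icc.reProdIm isCompact_Icc).exists_bound_of_continuousOn hcont
  refine ⟨max 1 (C * Real.exp (κ * T ^ 2)), fun z h1 h2 => ?_⟩
  rcases le_total T |z.im| with h | h
  · refine (hT _ h z rfl h1 h2).trans ?_
    exact le_mul_of_one_le_left (Real.exp_pos _).le (le_max_left _ _)
  · have h3 := hC z ⟨⟨h1, h2⟩, abs_le.mp h⟩
    have hC0 : 0 ≤ C := (norm_nonneg _).trans h3
    have h4 : z.im ^ 2 ≤ T ^ 2 := sq_le_sq' (abs_le.mp h).1 (abs_le.mp h).2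
    calc _ ≤ C := h3
      _ ≤ C * (Real.exp (κ * T ^ 2) * Real.exp (-κ * z.im ^ 2)) := by
        refine le_mul_of_one_le_right hC0 ?_
        rw [← Real.exp_add]
        refine Real.one_le_exp ?_
        nlinarith
      _ ≤ _ := by
        rw [← mul_assoc]
        gcongr
        exact le_max_right _ _

theorem KfunZ_eq_mellinInv (m n : ℕ) {p q : ℕ} (a : Fin p → ℂ) (b : Fin q → ℂ) (τ α : ℂ) (c : ℝ)
    {x : ℝ} (hx : 0 < x) :
    KfunZ m n a b τ α c x =
      mellinInv c (fun s => exp ((Real.pi : ℂ) * α / τ * s ^ 2) * calG m n a b s τ) x := by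
  rw [KfunZ, mellinInv, integral_mul_const, ← mul_assoc, mul_right_comm, real_smul]
  have hI : 1 / (2 * Real.pi * I) * I = ((1 / (2 * Real.pi) : ℝ) : ℂ) := by
    push_cast
    field_simp
  rw [hI]
  congr 1
  refine integral_congr_ae (Eventually.of_forall fun t => ?_)
  simp only [smul_eq_mul]
  rw [cpow_def_of_ne_zero (ofReal_ne_zero.mpr hx.ne'), ← ofReal_log hx.le,
    show -((c + t * I) * (Real.log x : ℂ)) = Real.log x * -(c + t * I) by ring]
  ring

theorem exists_between_of_finite {ι : Type*} [Finite ι] (P : ι → Prop) {f : ι → ℝ} {x : ℝ}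
    (h : ∀ j, P j → f j < x) : ∃ y < x, ∀ j, P j → f j < y := by
  have h1 : ∀ᶠ y in 𝓝[<] x, ∀ j, P j → f j < y := by
    refine eventually_all.mpr fun j => ?_
    by_cases hj : P j
    · filter_upwards [eventually_nhdsWithin_of_eventually_nhds (lt_mem_nhds (h j hj))] with y hy _
      exact hy
    · simp [hj]
  obtain ⟨y, hy, hyx⟩ := (h1.and self_mem_nhdsWithin).exists
  exact ⟨y, hyx, hy⟩


end

/-- The Mellin transform of the `K`-function recovers `e^{(πα/τ)s²}·𝒢(s)`. -/
theorem Kfun_mellin (τ : ℝ) (hτ : 0 < τ) (α : ℂ) (m n : ℕ) {p q : ℕ}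
    (hm : m ≤ q) (hn : n ≤ p) (a : Fin p → ℂ) (b : Fin q → ℂ)
    (hsep : ∀ j : Fin q, ∀ k : Fin p, m ≤ (j : ℕ) → n ≤ (k : ℕ) →
      (b j).re - τ - 1 < (a k).re)
    (hcase : 0 < paramN m n p q ∨ (paramN m n p q = 0 ∧ 0 < α.re))
    (c : ℝ)
    (hc1 : ∀ j : Fin q, m ≤ (j : ℕ) → (b j).re - τ - 1 < c)
    (hc2 : ∀ k : Fin p, n ≤ (k : ℕ) → c < (a k).re) :
    ∀ s : ℂ, (∀ j : Fin q, m ≤ (j : ℕ) → (b j).re - τ - 1 < s.re) →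
      (∀ k : Fin p, n ≤ (k : ℕ) → s.re < (a k).re) →
      MeasureTheory.IntegrableOn
        (fun x : ℝ => KfunZ m n a b (τ : ℂ) α c x * (x : ℂ) ^ (s - 1)) (Set.Ioi 0) ∧
      ∫ x in Set.Ioi (0 : ℝ), KfunZ m n a b (τ : ℂ) α c x * (x : ℂ) ^ (s - 1)
        = Complex.exp ((Real.pi : ℂ) * α / (τ : ℂ) * s ^ 2) * calG m n a b s (τ : ℂ) := by
  intro s hs1 hs2
  have hcase' : 0 < paramN m n p q ∨ (paramN m n p q = 0 ∧ 0 < ((Real.pi : ℂ) * α / τ).re) := by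
    refine hcase.imp_right fun h => ⟨h.1, ?_⟩
    rw [div_ofReal_re, re_ofReal_mul]
    have := h.2
    positivity
  obtain ⟨σ₁, hσ₁, hσ₁b⟩ := exists_between_of_finite (fun j : Fin q => m ≤ (j : ℕ))
    (f := fun j => (b j).re - τ - 1) (x := min c s.re)
    fun j hj => lt_min (hc1 j hj) (hs1 j hj)
  obtain ⟨y, hy, hya⟩ := exists_between_of_finite (fun k : Fin p => n ≤ (k : ℕ))
    (f := fun k => -(a k).re) (x := min (-c) (-s.re))
    fun k hk => lt_min (neg_lt_neg (hc2 k hk)) (neg_lt_neg (hs2 k hk))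
  have hσ₂a : ∀ k : Fin p, n ≤ (k : ℕ) → -y < (a k).re := fun k hk => by linarith [hya k hk]
  rw [lt_min_iff] at hσ₁ hy
  obtain ⟨κ, hκ, C, hbd⟩ := exists_gaussian_bound hτ ((Real.pi : ℂ) * α / τ) hm hn a b hcase'
    hσ₁b hσ₂a
  have hd : ∀ z : ℂ, σ₁ ≤ z.re → z.re ≤ -y → DifferentiableAt ℂ
      (fun s => exp ((Real.pi : ℂ) * α / τ * s ^ 2) * calG m n a b s τ) z := fun z h1 h2 =>
    DifferentiableAt.mul (by fun_prop) (differentiableAt_calG hτ m n a b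
      (fun j hj => (hσ₁b j hj).trans_le h1) (fun k hk => h2.trans_lt (hσ₂a k hk)))
  have hK : ∀ x ∈ Ioi (0 : ℝ), (x : ℂ) ^ (s - 1) • mellinInv s.re
      (fun s => exp ((Real.pi : ℂ) * α / τ * s ^ 2) * calG m n a b s τ) x =
      KfunZ m n a b (τ : ℂ) α c x * (x : ℂ) ^ (s - 1) := by
    intro x hx
    rw [KfunZ_eq_mellinInv m n a b τ α c hx, smul_eq_mul, mul_comm,
      mellinInv_eq_of_gaussian_decay hκ hd hbd ⟨hσ₁.1.le, by linarith⟩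
        ⟨hσ₁.2.le, by linarith⟩ hx]
  obtain ⟨h1, h2⟩ := mellin_mellinInv_of_gaussian_decay hκ hd hbd hσ₁.2 (by linarith)
  refine ⟨(integrableOn_congr_fun hK measurableSet_Ioi).mp h1, ?_⟩
  rw [← setIntegral_congr_fun measurableSet_Ioi hK]
  exact h2
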